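/- Let Δ(s) = 2^s·π^{s−1}·Γ(1−s)·sin(πs/2). For every compact interval [σ₁, σ₂] ⊂ ℝ there is a constant C > 0 such that for all σ ∈ [σ₁, σ₂] and all real t with |t| ≥ 1 for which Δ(σ+it) ≠ 0 and Δ is analytic at σ+it, | (Δ'/Δ)(σ+it) + log(|t|/(2π)) | ≤ C/|t|. -/

import Mathlib

open Complex Real

/-- The factor `Δ(s) = 2^s·π^{s−1}·Γ(1−s)·sin(πs/2)` from the functional equation
`ζ(s) = Δ(s)·ζ(1−s)` of the Riemann zeta function. -/
noncomputable def zetaDelta : ℂ → ℂ :=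
  fun s => 2 ^ s * (π : ℂ) ^ (s - 1) * Complex.Gamma (1 - s) * Complex.sin (π * s / 2)

open Filter Topology MeasureTheory Set

/-- Pointwise convergence of a bounded sequence of holomorphic functions on a closed disc implies
convergence of the derivatives at the centre. -/
theorem tendsto_deriv_of_tendsto_of_norm_le {F : ℕ → ℂ → ℂ} {g : ℂ → ℂ} {c : ℂ} {R M : ℝ}
    (hR : 0 < R) (hF : ∀ᶠ n in atTop, DifferentiableOn ℂ (F n) (Metric.closedBall c R))
    (hg : DifferentiableOn ℂ g (Metric.closedBall c R))
    (hM : ∀ᶠ n in atTop, ∀ z ∈ Metric.sphere c R, ‖F n z‖ ≤ M)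
    (hlim : ∀ z ∈ Metric.sphere c R, Tendsto (fun n => F n z) atTop (𝓝 (g z))) :
    Tendsto (fun n => deriv (F n) c) atTop (𝓝 (deriv g c)) := by
  have hne : (2 * π * I : ℂ) ≠ 0 := two_pi_I_ne_zero
  have key : Tendsto (fun n => ∮ z in C(c, R), (1 / (z - c) ^ 2) • F n z) atTop
      (𝓝 (∮ z in C(c, R), (1 / (z - c) ^ 2) • g z)) := by
    unfold circleIntegral
    have hsph : ∀ θ : ℝ, circleMap c R θ ∈ Metric.sphere c R :=
      fun θ => circleMap_mem_sphere c hR.le θ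
    refine intervalIntegral.tendsto_integral_filter_of_dominated_convergence
      (fun _ => R * (1 / R ^ 2 * M)) ?_ ?_ (by simp) ?_
    · filter_upwards [hF] with n hn
      refine Continuous.aestronglyMeasurable ?_
      have h1 : Continuous fun θ => F n (circleMap c R θ) :=
        hn.continuousOn.comp_continuous (continuous_circleMap c R)
          fun θ => Metric.sphere_subset_closedBall (hsph θ)
      have h2 : Continuous fun θ => 1 / (circleMap c R θ - c) ^ 2 := by
        refine continuous_const.div (by fun_prop) fun θ => ?_
        simp [circleMap, hR.ne']
      simp only [deriv_circleMap]
      exact (by fun_prop : Continuous fun θ => circleMap 0 R θ * I).smul (h2.smul h1)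
    · filter_upwards [hM] with n hn
      refine Eventually.of_forall fun θ _ => ?_
      simp only [deriv_circleMap, norm_smul, norm_mul, norm_circleMap_zero, norm_I, mul_one,
        norm_div, norm_one, norm_pow, circleMap_sub_center, abs_of_pos hR]
      gcongr
      exact hn _ (hsph θ)
    · refine Eventually.of_forall fun θ _ => ?_
      exact ((hlim _ (hsph θ)).const_smul _).const_smul _
  rw [hg.deriv_eq_smul_circleIntegral hR] at key
  have := (key.const_smul (2 * π * I : ℂ)⁻¹).congr' (f₂ := fun n => deriv (F n) c) <| by
    filter_upwards [hF] with n hn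
    rw [hn.deriv_eq_smul_circleIntegral hR, inv_smul_smul₀ hne]
  rwa [inv_smul_smul₀ hne] at this

theorem norm_GammaSeq_le {s : ℂ} (hs : 0 < s.re) {n : ℕ} (hn : n ≠ 0) :
    ‖Complex.GammaSeq s n‖ ≤ Real.Gamma s.re := by
  rw [GammaSeq_eq_approx_Gamma_integral hs hn, Real.Gamma_eq_integral hs]
  have hint := Real.GammaIntegral_convergent hs
  have hn0 : (0 : ℝ) ≤ n := Nat.cast_nonneg n
  calc ‖∫ x : ℝ in 0..n, ↑((1 - x / n) ^ n) * (x : ℂ) ^ (s - 1)‖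
      ≤ ∫ x : ℝ in 0..n, Real.exp (-x) * x ^ (s.re - 1) := by
        refine intervalIntegral.norm_integral_le_of_norm_le hn0 ?_ ?_
        · refine Eventually.of_forall fun x hx => ?_
          have h0 : 0 ≤ 1 - x / n := by
            rw [sub_nonneg]
            exact div_le_one_of_le₀ hx.2 hn0
          rw [norm_mul, norm_cpow_eq_rpow_re_of_pos hx.1, sub_re, one_re, Complex.norm_real,
            Real.norm_of_nonneg (pow_nonneg h0 n)]
          have := hx.1.le
          gcongr
          exact one_sub_div_pow_le_exp_neg hx.2
        · rw [intervalIntegrable_iff_integrableOn_Ioc_of_le hn0]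
          exact hint.mono_set Ioc_subset_Ioi_self
    _ ≤ ∫ x in Ioi (0 : ℝ), Real.exp (-x) * x ^ (s.re - 1) := by
        rw [intervalIntegral.integral_of_le hn0]
        refine setIntegral_mono_set hint ?_ Ioc_subset_Ioi_self.eventuallyLE
        filter_upwards [ae_restrict_mem measurableSet_Ioi] with x hx
        have : 0 ≤ x := le_of_lt hx
        positivity

theorem hasDerivAt_GammaSeq {s : ℂ} (hs : 0 < s.re) {n : ℕ} (hn : n ≠ 0) :
    HasDerivAt (fun z => Complex.GammaSeq z n)
      (Complex.GammaSeq s n *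
        (Complex.log n - ∑ k ∈ Finset.range (n + 1), (s + k)⁻¹)) s := by
  have hne : ∀ k ∈ Finset.range (n + 1), s + (k : ℂ) ≠ 0 := fun k _ h => by
    have := congrArg re h
    simp only [add_re, natCast_re, zero_re] at this
    linarith [(Nat.cast_nonneg k : (0 : ℝ) ≤ k)]
  have hn' : (n : ℂ) ≠ 0 := Nat.cast_ne_zero.mpr hn
  have hprod : HasDerivAt (fun z : ℂ => ∏ j ∈ Finset.range (n + 1), (z + (j : ℂ)))
      ((∏ j ∈ Finset.range (n + 1), (s + (j : ℂ))) *
        ∑ k ∈ Finset.range (n + 1), (s + k)⁻¹) s := by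
    have := HasDerivAt.fun_finsetProd (u := Finset.range (n + 1))
      (f := fun (j : ℕ) (z : ℂ) => z + (j : ℂ)) (f' := fun _ => (1 : ℂ)) (x := s)
      (fun k _ => (hasDerivAt_id s).add_const (k : ℂ))
    convert! this using 1
    rw [Finset.mul_sum]
    refine Finset.sum_congr rfl fun k hk => ?_
    rw [← Finset.mul_prod_erase _ _ hk, smul_eq_mul, mul_one]
    field_simp [hne k hk]
  have hP := Finset.prod_ne_zero_iff.mpr hne
  have hpow : HasDerivAt (fun z : ℂ => (n : ℂ) ^ z) ((n : ℂ) ^ s * Complex.log n) s := by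
    simpa using (hasDerivAt_id s).const_cpow (Or.inl hn')
  have := (hpow.mul_const (n.factorial : ℂ)).div hprod hP
  unfold Complex.GammaSeq
  convert! this using 1
  field_simp

theorem ne_neg_natCast_of_re_pos {s : ℂ} (hs : 0 < s.re) (m : ℕ) : s ≠ -(m : ℂ) := fun h => by
  have := congrArg re h
  simp only [neg_re, natCast_re] at this
  linarith [(Nat.cast_nonneg m : (0 : ℝ) ≤ m)]

theorem ne_neg_natCast_of_im_ne_zero {s : ℂ} (hs : s.im ≠ 0) (m : ℕ) : s ≠ -(m : ℂ) :=
  fun h => hs (by simp [h])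

/-- Euler's limit formula for the digamma function on the right half-plane. -/
theorem tendsto_log_sub_sum_inv_digamma {s : ℂ} (hs : 0 < s.re) :
    Tendsto (fun n : ℕ => Complex.log n - ∑ k ∈ Finset.range (n + 1), (s + k)⁻¹) atTop
      (𝓝 (digamma s)) := by
  have hre : ∀ z ∈ Metric.closedBall s (s.re / 2), 0 < z.re := fun z hz => by
    have h1 := (abs_re_le_norm (z - s)).trans (mem_closedBall_iff_norm.mp hz)
    rw [sub_re] at h1
    linarith [(abs_le.mp h1).1]
  obtain ⟨M, hM⟩ := (isCompact_sphere s (s.re / 2)).exists_bound_of_continuousOn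
    (f := fun z : ℂ => Real.Gamma z.re) <|
      Real.differentiableOn_Gamma_Ioi.continuousOn.comp continuous_re.continuousOn
        fun z hz => hre z (Metric.sphere_subset_closedBall hz)
  have hderiv := tendsto_deriv_of_tendsto_of_norm_le (F := fun n z => Complex.GammaSeq z n)
    (g := Complex.Gamma) (M := M) (half_pos hs)
    (by
      filter_upwards [eventually_ne_atTop 0] with n hn z hz
      exact (hasDerivAt_GammaSeq (hre z hz) hn).differentiableAt.differentiableWithinAt)
    (fun z hz => (differentiableAt_Gamma z
      (ne_neg_natCast_of_re_pos (hre z hz))).differentiableWithinAt)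
    (by
      filter_upwards [eventually_ne_atTop 0] with n hn z hz
      exact (norm_GammaSeq_le (hre z (Metric.sphere_subset_closedBall hz)) hn).trans
        ((le_abs_self _).trans (hM z hz)))
    (fun z _ => GammaSeq_tendsto_Gamma z)
  have hG : Complex.Gamma s ≠ 0 := Complex.Gamma_ne_zero_of_re_pos hs
  have hlim := GammaSeq_tendsto_Gamma s
  refine (hderiv.div hlim hG).congr' ?_
  filter_upwards [eventually_ne_atTop 0, hlim.eventually_ne hG] with n hn hn'
  rw [Pi.div_apply, (hasDerivAt_GammaSeq hs hn).deriv, mul_div_cancel_left₀ _ hn']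

theorem hasDerivAt_log_add_ofReal {w : ℂ} (hw : w.im ≠ 0) (x : ℝ) :
    HasDerivAt (fun y : ℝ => Complex.log (w + y)) (w + x)⁻¹ x := by
  have h : HasDerivAt (fun y : ℝ => w + (y : ℂ)) 1 x :=
    (Complex.ofRealCLM.hasDerivAt (x := x)).const_add w
  have := h.clog_real (Or.inr (by simpa using hw))
  simpa using this

theorem norm_log_add_ofReal_sub_log_le {w : ℂ} (hw : w.im ≠ 0) (x : ℝ) :
    ‖Complex.log (w + x) - Complex.log w‖ ≤ |x| / |w.im| := by
  have h := convex_univ.norm_image_sub_le_of_norm_hasDerivWithin_le (C := |w.im|⁻¹)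
    (fun y _ => (hasDerivAt_log_add_ofReal hw y).hasDerivWithinAt)
    (fun y _ => by
      rw [norm_inv]
      have := abs_im_le_norm (w + y)
      simp only [add_im, ofReal_im, add_zero] at this
      exact inv_anti₀ (abs_pos.mpr hw) this) (mem_univ 0) (mem_univ x)
  simpa [div_eq_inv_mul] using h

theorem norm_inv_sub_log_add_one_sub_log_le {w : ℂ} (hre : 0 ≤ w.re) (him : w.im ≠ 0) :
    ‖w⁻¹ - (Complex.log (w + 1) - Complex.log w)‖ ≤ (w.re ^ 2 + w.im ^ 2)⁻¹ := by
  have hw : w ≠ 0 := fun h => him (by simp [h])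
  have hsq : w.re ^ 2 + w.im ^ 2 = ‖w‖ ^ 2 := by rw [Complex.sq_norm, normSq_apply]; ring
  have h := norm_image_sub_le_of_norm_deriv_le_segment_01' (C := (w.re ^ 2 + w.im ^ 2)⁻¹)
    (f := fun x : ℝ => (x : ℂ) * w⁻¹ - Complex.log (w + x)) (f' := fun x : ℝ => w⁻¹ - (w + x)⁻¹)
    (fun x _ => by
      have h1 := (Complex.ofRealCLM.hasDerivAt (x := x)).mul_const w⁻¹
      simp only [ofRealCLM_apply, ofReal_one, one_mul] at h1
      exact (h1.sub (hasDerivAt_log_add_ofReal him x)).hasDerivWithinAt)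
    (fun x hx => by
      have hwx : w + (x : ℂ) ≠ 0 := fun h => him (by simpa using congrArg im h)
      have hle : ‖w‖ ≤ ‖w + x‖ := by
        rw [← abs_of_nonneg (norm_nonneg w), ← abs_of_nonneg (norm_nonneg (w + x)), ← sq_le_sq,
          Complex.sq_norm, Complex.sq_norm, normSq_apply, normSq_apply]
        simp only [add_re, ofReal_re, add_im, ofReal_im, add_zero]
        nlinarith [hx.1, mul_nonneg hre hx.1]
      have hpos : 0 < ‖w‖ := norm_pos_iff.mpr hw
      rw [inv_sub_inv hw hwx, add_sub_cancel_left, norm_div, norm_mul, Complex.norm_real,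
        Real.norm_of_nonneg hx.1, hsq, sq, ← one_div]
      gcongr
      exact hx.2.le)
  have heq : w⁻¹ - (Complex.log (w + 1) - Complex.log w)
      = (((1 : ℝ) : ℂ) * w⁻¹ - Complex.log (w + (1 : ℝ)))
        - (((0 : ℝ) : ℂ) * w⁻¹ - Complex.log (w + (0 : ℝ))) := by
    push_cast
    rw [add_zero]
    ring
  rw [heq]
  exact h

theorem sum_inv_sq_add_sq_le {y : ℝ} (hy : 1 ≤ y) (n : ℕ) :
    ∑ k ∈ Finset.range n, ((k : ℝ) ^ 2 + y ^ 2)⁻¹ ≤ 4 / y := by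
  have key : ∑ k ∈ Finset.range n, ((k : ℝ) ^ 2 + y ^ 2)⁻¹
      ≤ 2 / (y - 1 / 2) - 2 / (n + y - 1 / 2) := by
    induction n with
    | zero => simp
    | succ n ih =>
      rw [Finset.sum_range_succ]
      have hn : (0 : ℝ) ≤ n := Nat.cast_nonneg n
      have h1 : 0 < n + y - 1 / 2 := by linarith
      have h2 : 0 < n + 1 + y - 1 / 2 := by linarith
      have : ((n : ℝ) ^ 2 + y ^ 2)⁻¹ ≤ 2 / (n + y - 1 / 2) - 2 / (n + 1 + y - 1 / 2) := by
        rw [div_sub_div _ _ h1.ne' h2.ne', inv_eq_one_div,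
          div_le_div_iff₀ (by positivity) (by positivity)]
        nlinarith [sq_nonneg ((n : ℝ) - y)]
      push_cast
      linarith
  have h3 : 2 / (y - 1 / 2) ≤ 4 / y := by
    rw [div_le_div_iff₀ (by linarith) (by linarith)]
    linarith
  have h4 : 0 ≤ 2 / (n + y - 1 / 2) := by
    have hn : (0 : ℝ) ≤ n := Nat.cast_nonneg n
    exact div_nonneg zero_le_two (by linarith)
  linarith

theorem tendsto_log_natCast_sub_log_add_natCast (a : ℂ) :
    Tendsto (fun n : ℕ => Complex.log n - Complex.log (a + n)) atTop (𝓝 0) := by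
  have h1 : Tendsto (fun n : ℕ => 1 + a / (n : ℂ)) atTop (𝓝 1) := by
    simpa using (tendsto_const_div_atTop_nhds_zero_nat a).const_add 1
  have h2 := (h1.clog (by simp)).neg
  rw [Complex.log_one, neg_zero] at h2
  refine h2.congr' ?_
  filter_upwards [eventually_gt_atTop 0, h1.eventually_ne one_ne_zero] with n hn hne
  have hn' : (n : ℂ) ≠ 0 := Nat.cast_ne_zero.mpr hn.ne'
  have heq : a + (n : ℂ) = ((n : ℝ) : ℂ) * (1 + a / n) := by
    push_cast
    field_simp
    ring
  rw [heq, Complex.log_ofReal_mul (Nat.cast_pos.mpr hn) hne, natCast_log]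
  ring

theorem norm_digamma_sub_log_le {s : ℂ} (hre : 0 < s.re) (him : 1 ≤ |s.im|) :
    ‖digamma s - Complex.log s‖ ≤ 4 / |s.im| := by
  have him0 : s.im ≠ 0 := abs_pos.mp (by linarith)
  have hlim := ((tendsto_log_sub_sum_inv_digamma hre).sub_const (Complex.log s)).sub
    (tendsto_log_natCast_sub_log_add_natCast (s + 1))
  rw [sub_zero] at hlim
  refine le_of_tendsto' hlim.norm fun n => ?_
  have htel : Complex.log (s + 1 + n) - Complex.log s = ∑ k ∈ Finset.range (n + 1),
      (Complex.log (s + k + 1) - Complex.log (s + k)) := by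
    have := Finset.sum_range_sub (fun k : ℕ => Complex.log (s + k)) (n + 1)
    push_cast at this
    simp only [add_zero, ← add_assoc] at this
    rw [this, add_right_comm]
  have heq : Complex.log n - ∑ k ∈ Finset.range (n + 1), (s + k)⁻¹ - Complex.log s
      - (Complex.log n - Complex.log (s + 1 + n))
      = -∑ k ∈ Finset.range (n + 1),
        ((s + k)⁻¹ - (Complex.log (s + k + 1) - Complex.log (s + k))) := by
    rw [Finset.sum_sub_distrib, ← htel]
    ring
  rw [heq, norm_neg]
  refine ((norm_sum_le _ _).trans (Finset.sum_le_sum fun k _ => ?_)).trans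
    (sum_inv_sq_add_sq_le him (n + 1))
  have hk : (0 : ℝ) ≤ k := Nat.cast_nonneg k
  have h := norm_inv_sub_log_add_one_sub_log_le (w := s + k)
    (by simp; linarith) (by simpa using him0)
  refine h.trans ?_
  simp only [add_re, natCast_re, add_im, natCast_im, add_zero, sq_abs]
  gcongr
  linarith

theorem norm_digamma_sub_log_im_mul_I_le (N : ℕ) {w : ℂ} (hre : -(N : ℝ) < w.re)
    (him : 1 ≤ |w.im|) :
    ‖digamma w - Complex.log (w.im * I)‖ ≤ (4 + w.re + 2 * N) / |w.im| := by
  have him0 : w.im ≠ 0 := abs_pos.mp (by linarith)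
  induction N generalizing w with
  | zero =>
    have hre' : 0 < w.re := by simpa using hre
    have h1 := norm_digamma_sub_log_le hre' him
    have h2 := norm_log_add_ofReal_sub_log_le (w := w.im * I) (by simpa using him0) w.re
    rw [add_comm _ (w.re : ℂ), re_add_im, abs_of_pos hre'] at h2
    simp only [mul_im, ofReal_re, I_im, mul_one, ofReal_im, I_re, mul_zero, add_zero] at h2
    have h3 := norm_add_le (digamma w - Complex.log w)
      (Complex.log w - Complex.log (w.im * I))
    rw [sub_add_sub_cancel] at h3
    refine h3.trans ((add_le_add h1 h2).trans_eq ?_)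
    rw [← add_div]
    simp
  | succ N ih =>
    push_cast at hre
    have h1 := ih (w := w + 1) (by simp; linarith) (by simpa using him) (by simpa using him0)
    rw [digamma_apply_add_one w (ne_neg_natCast_of_im_ne_zero him0)] at h1
    simp only [add_im, one_im, add_zero, add_re, one_re] at h1
    have h2 : ‖w⁻¹‖ ≤ 1 / |w.im| := by
      rw [norm_inv, ← one_div]
      exact one_div_le_one_div_of_le (by linarith) (abs_im_le_norm w)
    have h3 := norm_sub_le (digamma w + w⁻¹ - Complex.log (w.im * I)) w⁻¹
    have heq : digamma w + w⁻¹ - Complex.log (w.im * I) - w⁻¹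
      = digamma w - Complex.log (w.im * I) := by ring
    rw [heq] at h3
    refine h3.trans ((add_le_add h1 h2).trans_eq ?_)
    rw [← add_div]
    push_cast
    ring

theorem log_ofReal_mul_I {y : ℝ} (hy : y ≠ 0) :
    Complex.log (y * I) = Real.log |y| + Real.sign y * (π / 2 * I) := by
  rcases hy.lt_or_gt with h | h
  · have heq : (y : ℂ) * I = ((-y : ℝ) : ℂ) * (-I) := by push_cast; ring
    rw [heq, Complex.log_ofReal_mul (by linarith) (by simp), Complex.log_neg_I, abs_of_neg h,
      Real.sign_of_neg h]
    push_cast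
    ring
  · rw [Complex.log_ofReal_mul h I_ne_zero, Complex.log_I, abs_of_pos h, Real.sign_of_pos h]
    simp

theorem le_two_mul_norm_sin {z : ℂ} (hz : 0 < z.im) : z.im ≤ 2 * ‖Complex.sin z‖ := by
  have h := norm_sub_norm_le (cexp (-z * I)) (cexp (z * I))
  have h2 : cexp (-z * I) - cexp (z * I) = -(2 * I * Complex.sin z) := by
    rw [Complex.sin]
    linear_combination (cexp (-z * I) - cexp (z * I)) * I_sq
  rw [h2, norm_neg, norm_mul, norm_mul, norm_I, Complex.norm_exp, Complex.norm_exp] at h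
  simp only [mul_re, neg_re, I_re, mul_zero, neg_im, I_im, mul_one, zero_sub, neg_neg,
    Complex.norm_ofNat] at h
  linarith [Real.add_one_le_exp z.im, Real.exp_le_one_iff.mpr (neg_nonpos.mpr hz.le)]

theorem sin_ne_zero_of_im_ne_zero {z : ℂ} (hz : z.im ≠ 0) : Complex.sin z ≠ 0 := by
  rcases hz.lt_or_gt with h | h
  · have := le_two_mul_norm_sin (z := -z) (by simpa using h)
    rw [Complex.sin_neg, norm_neg, neg_im] at this
    exact norm_pos_iff.mp (by linarith)
  · exact norm_pos_iff.mp (by linarith [le_two_mul_norm_sin h])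

theorem norm_cot_add_sign_mul_I_le {z : ℂ} (hz : z.im ≠ 0) :
    ‖Complex.cot z + Real.sign z.im * I‖ ≤ 2 / |z.im| := by
  have key : ∀ {z : ℂ}, 0 < z.im → ‖Complex.cot z + I‖ ≤ 2 / z.im := fun {z} hz => by
    have hs := sin_ne_zero_of_im_ne_zero hz.ne'
    have heq : Complex.cot z + I = cexp (z * I) / Complex.sin z := by
      rw [Complex.cot, Complex.exp_mul_I]
      field_simp
    rw [heq, norm_div, div_le_div_iff₀ (norm_pos_iff.mpr hs) hz, Complex.norm_exp]
    have h1 : Real.exp (z * I).re ≤ 1 := Real.exp_le_one_iff.mpr (by simpa using hz.le)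
    exact (mul_le_of_le_one_left hz.le h1).trans (le_two_mul_norm_sin hz)
  rcases hz.lt_or_gt with h | h
  · have := key (z := -z) (by simpa using h)
    have heq : Complex.cot (-z) + I = -(Complex.cot z - I) := by
      rw [Complex.cot, Complex.cot, Complex.cos_neg, Complex.sin_neg]
      ring
    rw [heq, norm_neg, neg_im] at this
    rw [abs_of_neg h, Real.sign_of_neg h]
    simpa [sub_eq_add_neg] using this
  · rw [abs_of_pos h, Real.sign_of_pos h]
    simpa using key h

theorem logDeriv_zetaDelta {s : ℂ} (hs : s.im ≠ 0) :
    logDeriv zetaDelta s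
      = Real.log (2 * π) - digamma (1 - s) + π / 2 * Complex.cot (π * s / 2) := by
  have hπ : (π : ℂ) ≠ 0 := ofReal_ne_zero.mpr pi_ne_zero
  have hw : ∀ m : ℕ, 1 - s ≠ -(m : ℂ) := ne_neg_natCast_of_im_ne_zero (by simpa using hs)
  have hΓ0 : Complex.Gamma (1 - s) ≠ 0 := Complex.Gamma_ne_zero hw
  have him : (π * s / 2 : ℂ).im ≠ 0 := by
    have heq : (π * s / 2 : ℂ) = ((π / 2 : ℝ) : ℂ) * s := by push_cast; ring
    rw [heq, im_ofReal_mul]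
    exact mul_ne_zero (by positivity) hs
  have hsin0 := sin_ne_zero_of_im_ne_zero him
  have h2 : HasDerivAt (fun z : ℂ => (2 : ℂ) ^ z) (2 ^ s * Complex.log 2) s := by
    simpa using (hasDerivAt_id s).const_cpow (Or.inl two_ne_zero)
  have hp : HasDerivAt (fun z : ℂ => (π : ℂ) ^ (z - 1)) (π ^ (s - 1) * Complex.log π) s := by
    simpa using ((hasDerivAt_id s).sub_const 1).const_cpow (Or.inl hπ)
  have hΓ : HasDerivAt (fun z : ℂ => Complex.Gamma (1 - z))
      (-(Complex.Gamma (1 - s) * digamma (1 - s))) s := by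
    rw [digamma_def, logDeriv_apply, mul_div_cancel₀ _ hΓ0]
    exact (differentiableAt_Gamma _ hw).hasDerivAt.comp_const_sub 1 s
  have hsin : HasDerivAt (fun z : ℂ => Complex.sin (π * z / 2))
      (Complex.cos (π * s / 2) * (π / 2)) s := by
    have := (((hasDerivAt_id s).const_mul (π : ℂ)).div_const 2).csin
    simpa using this
  have hd := (((h2.mul hp).mul hΓ).mul hsin).deriv
  have h20 : (2 : ℂ) ^ s ≠ 0 := by simp [cpow_eq_zero_iff]
  have hp0 : (π : ℂ) ^ (s - 1) ≠ 0 := by simp [cpow_eq_zero_iff, hπ]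
  have hlog : ((Real.log (2 * π) : ℝ) : ℂ) = Complex.log 2 + Complex.log π := by
    rw [Real.log_mul two_ne_zero pi_ne_zero, ofReal_add, ofReal_log zero_le_two,
      ofReal_log pi_pos.le, ofReal_ofNat]
  rw [logDeriv_apply, hlog, Complex.cot]
  refine (congrArg (· / zetaDelta s) hd).trans ?_
  simp only [zetaDelta, Pi.mul_apply]
  generalize Complex.sin (π * s / 2) = S at *
  field_simp
  ring

/-- For every compact interval `[σ₁, σ₂]` there is a constant `C > 0` such that for all
`σ ∈ [σ₁, σ₂]` and all real `t` with `|t| ≥ 1` for which `Δ(σ+it) ≠ 0` and `Δ` is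
analytic at `σ+it`, one has `|(Δ'/Δ)(σ+it) + log(|t|/(2π))| ≤ C/|t|`. -/
theorem zetaDelta_logDeriv_asymptotic (σ₁ σ₂ : ℝ) :
    ∃ C : ℝ, 0 < C ∧ ∀ σ t : ℝ, σ₁ ≤ σ → σ ≤ σ₂ → 1 ≤ |t| →
      zetaDelta (σ + t * I) ≠ 0 → AnalyticAt ℂ zetaDelta (σ + t * I) →
      ‖deriv zetaDelta (σ + t * I) / zetaDelta (σ + t * I) +
        (Real.log (|t| / (2 * π)) : ℂ)‖ ≤ C / |t| := by
  obtain ⟨N, hN⟩ := exists_nat_gt |σ₂|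
  refine ⟨7 + |σ₁| + 2 * N, by positivity, fun σ t h₁ h₂ ht _ _ => ?_⟩
  have ht0 : t ≠ 0 := abs_pos.mp (by linarith)
  have hs : (σ + t * I : ℂ).im = t := by simp
  have hwre : (1 - (σ + t * I) : ℂ).re = 1 - σ := by simp
  have hwim : (1 - (σ + t * I) : ℂ).im = -t := by simp
  have hzim : (π * (σ + t * I) / 2 : ℂ).im = π / 2 * t := by
    have heq : (π * (σ + t * I) / 2 : ℂ) = ((π / 2 : ℝ) : ℂ) * (σ + t * I) := by push_cast; ring
    rw [heq, im_ofReal_mul, hs]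
  have hψ := norm_digamma_sub_log_im_mul_I_le N (w := 1 - (σ + t * I))
    (by rw [hwre]; linarith [le_abs_self σ₂]) (by rwa [hwim, abs_neg])
  have hcot := norm_cot_add_sign_mul_I_le (z := π * (σ + t * I) / 2)
    (by rw [hzim]; positivity)
  have hsign : Real.sign (π / 2 * t) = Real.sign t := by
    rcases ht0.lt_or_gt with h | h
    · rw [Real.sign_of_neg h, Real.sign_of_neg (mul_neg_of_pos_of_neg (by positivity) h)]
    · rw [Real.sign_of_pos h, Real.sign_of_pos (by positivity)]
  rw [hwre, hwim, log_ofReal_mul_I (neg_ne_zero.mpr ht0), abs_neg, Real.sign_neg] at hψ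
  rw [hzim, hsign, abs_mul, abs_of_pos (by positivity : 0 < π / 2)] at hcot
  rw [← logDeriv_apply, logDeriv_zetaDelta (by rwa [hs]),
    Real.log_div (by positivity) (by positivity)]
  have heq : (Real.log (2 * π) - digamma (1 - (σ + t * I))
        + π / 2 * Complex.cot (π * (σ + t * I) / 2)
        + ((Real.log |t| - Real.log (2 * π) : ℝ) : ℂ) : ℂ)
      = ((π / 2 : ℝ) : ℂ) * (Complex.cot (π * (σ + t * I) / 2) + Real.sign t * I)
        - (digamma (1 - (σ + t * I))
          - (Real.log |t| + (-Real.sign t : ℝ) * (π / 2 * I))) := by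
    push_cast
    ring
  rw [heq]
  refine (norm_sub_le _ _).trans ?_
  rw [norm_mul, Complex.norm_real, Real.norm_of_nonneg (by positivity)]
  calc π / 2 * ‖Complex.cot (π * (σ + t * I) / 2) + Real.sign t * I‖ + _
      ≤ π / 2 * (2 / (π / 2 * |t|)) + (4 + (1 - σ) + 2 * N) / |t| := by gcongr
    _ = (7 - σ + 2 * N) / |t| := by
      field_simp
      ring
    _ ≤ (7 + |σ₁| + 2 * N) / |t| := by
      gcongr
      linarith [neg_abs_le σ₁]
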